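/- (Two-tails regime, stable case of the generator convergence.) Fix d ≥ 1, u₀ > 0, p ∈ [1,∞], and parameters a₁ ∈ (0,2) and a₂ > a₁. For δ ∈ (0,1) define, for twice continuously differentiable φ : ℝ^d → ℝ with max_{|κ|≤2} ‖∂_κ φ‖_p < ∞, L^δ φ(x) := u₀ V₁ ∫_δ^∞ ∫₁^∞ ( φ̄̄(x, r₁, δ r₂) − φ(x) ) dr₁ dr₂ / ( r₁^{1+a₁} r₂^{1+a₂} ) and D^δ φ(x) := (u₀ V₁ / a₂) ∫_δ^∞ ( φ̄(x,r) − φ(x) ) dr/r^{1+a₁}. Then there exist constants C > 0 and θ > 0 such that for all δ ∈ (0,1) and all such φ: ‖ L^δ φ − D^δ φ ‖_p ≤ C δ^θ max_{|κ|≤2} ‖∂_κ φ‖_p. -/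

import Mathlib

open MeasureTheory Metric Set
open scoped ENNReal

noncomputable section

/-- Euclidean space `ℝ^d`. -/
abbrev Euc (d : ℕ) : Type := EuclideanSpace ℝ (Fin d)

/-- The ball average `φ̄(x,r) = (1/V_r) ∫_{B(x,r)} φ(y) dy` (with `φ̄(x,0) = φ(x)`). -/
def ballAvg {d : ℕ} (φ : Euc d → ℝ) (r : ℝ) (x : Euc d) : ℝ :=
  if r = 0 then φ x
  else ((volume (Metric.ball x r)).toReal)⁻¹ * ∫ y in Metric.ball x r, φ y

/-- The double ball average `φ̄̄(x,r,s) = (1/(V_r V_s)) ∫_{B(x,r)} ∫_{B(y,s)} φ(z) dz dy`. -/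
def doubleAvg {d : ℕ} (φ : Euc d → ℝ) (r s : ℝ) (x : Euc d) : ℝ :=
  ballAvg (ballAvg φ s) r x

/-- Partial derivative of `ψ` in the `i`-th coordinate direction. -/
def pd {d : ℕ} (i : Fin d) (ψ : Euc d → ℝ) (x : Euc d) : ℝ :=
  fderiv ℝ ψ x (EuclideanSpace.single i 1)

/-- Iterated partial derivative `∂_κ` along a list of coordinate directions. -/
def listD {d : ℕ} : List (Fin d) → (Euc d → ℝ) → Euc d → ℝ
  | [], ψ => ψ
  | i :: l, ψ => pd i (listD l ψ)

/-- The Laplacian `Δφ = ∑ i ∂²φ/∂x_i²`. -/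
def lap {d : ℕ} (φ : Euc d → ℝ) (x : Euc d) : ℝ := ∑ i : Fin d, listD [i, i] φ x

/-- The volume of the unit ball in `ℝ^d`. -/
def V1 (d : ℕ) : ℝ := (volume (Metric.ball (0 : Euc d) 1)).toReal

/-- `max_{|κ| ≤ n} ‖∂_κ φ‖_p`. -/
def maxDle {d : ℕ} (n : ℕ) (φ : Euc d → ℝ) (p : ℝ≥0∞) : ℝ≥0∞ :=
  ⨆ (l : List (Fin d)) (_ : l.length ≤ n), eLpNorm (listD l φ) p volume


theorem mink_aux {X Y : Type*} [MeasurableSpace X] [MeasurableSpace Y] (μ : Measure X) [SFinite μ]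
    (ν : Measure Y) [IsFiniteMeasure ν] (p : ℝ≥0∞) (hp : 1 ≤ p) (f : X → Y → ℝ≥0∞)
    (hf : Measurable (Function.uncurry f)) (K : ℝ≥0∞)
    (hK : ∀ᵐ y ∂ν, eLpNorm (fun x => f x y) p μ ≤ K) :
    eLpNorm (fun x => ∫⁻ y, f x y ∂ν) p μ ≤ ν univ * K := by
  have hp0 : p ≠ 0 := (zero_lt_one.trans_le hp).ne'
  by_cases hpt : p = ⊤
  · subst hpt
    simp only [eLpNorm_exponent_top] at *
    have h1 : ∀ᵐ y ∂ν, ∀ᵐ x ∂μ, f x y ≤ K := by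
      filter_upwards [hK] with y hy
      filter_upwards [enorm_ae_le_eLpNormEssSup (fun x => f x y) μ] with x hx
      exact (by simpa using hx : f x y ≤ _).trans hy
    have h2 : ∀ᵐ x ∂μ, ∀ᵐ y ∂ν, f x y ≤ K := by
      rw [Measure.ae_ae_comm]
      · exact h1
      · exact measurableSet_le hf measurable_const
    refine eLpNormEssSup_le_of_ae_enorm_bound ?_
    filter_upwards [h2] with x hx
    calc ‖∫⁻ y, f x y ∂ν‖ₑ = ∫⁻ y, f x y ∂ν := by simp
      _ ≤ ∫⁻ y, K ∂ν := lintegral_mono_ae hx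
      _ = ν univ * K := by simp [mul_comm]
  · set q := p.toReal with hq
    have hq1 : 1 ≤ q := by
      rw [hq, ← ENNReal.toReal_one]
      exact ENNReal.toReal_mono hpt hp
    have hq0 : 0 < q := by linarith
    rw [eLpNorm_eq_lintegral_rpow_enorm_toReal hp0 hpt]
    have hK' : ∀ᵐ y ∂ν, ∫⁻ x, f x y ^ q ∂μ ≤ K ^ q := by
      filter_upwards [hK] with y hy
      rw [eLpNorm_eq_lintegral_rpow_enorm_toReal hp0 hpt] at hy
      simp only [enorm_eq_self] at hy
      have := ENNReal.rpow_le_rpow hy hq0.le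
      rwa [← ENNReal.rpow_mul, one_div, inv_mul_cancel₀ hq0.ne', ENNReal.rpow_one] at this
    have hJ : ∀ x, (∫⁻ y, f x y ∂ν) ^ q ≤ (ν univ) ^ (q - 1) * ∫⁻ y, f x y ^ q ∂ν := by
      intro x
      have hm : Measurable (f x) := hf.comp measurable_prodMk_left
      have := eLpNorm_le_eLpNorm_mul_rpow_measure_univ (μ := ν) (f := f x) hp
        hm.aestronglyMeasurable
      rw [eLpNorm_one_eq_lintegral_enorm, eLpNorm_eq_lintegral_rpow_enorm_toReal hp0 hpt] at this
      simp only [enorm_eq_self] at this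
      have h := ENNReal.rpow_le_rpow this hq0.le
      rw [ENNReal.mul_rpow_of_nonneg _ _ hq0.le, ← ENNReal.rpow_mul, ← ENNReal.rpow_mul,
        one_div, inv_mul_cancel₀ hq0.ne', ENNReal.rpow_one, mul_comm] at h
      refine h.trans_eq ?_
      congr 2
      rw [← hq, ENNReal.toReal_one]
      field_simp
    simp only [enorm_eq_self]
    have hmq : Measurable (Function.uncurry fun x y => f x y ^ q) := hf.pow_const q
    calc (∫⁻ x, (∫⁻ y, f x y ∂ν) ^ q ∂μ) ^ (1 / q)
        ≤ (∫⁻ x, (ν univ) ^ (q - 1) * ∫⁻ y, f x y ^ q ∂ν ∂μ) ^ (1 / q) := by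
          gcongr with x; exact hJ x
      _ = ((ν univ) ^ (q - 1) * ∫⁻ y, ∫⁻ x, f x y ^ q ∂μ ∂ν) ^ (1 / q) := by
          rw [lintegral_const_mul, lintegral_lintegral_swap]
          · exact hmq.aemeasurable
          · exact hmq.lintegral_prod_right
      _ ≤ ((ν univ) ^ (q - 1) * ∫⁻ y, K ^ q ∂ν) ^ (1 / q) := by
          gcongr 2
          exact lintegral_mono_ae hK'
      _ = ((ν univ) ^ q * K ^ q) ^ (1 / q) := by
          congr 1
          rw [lintegral_const, mul_comm (K ^ q), ← mul_assoc]
          congr 1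
          by_cases h0 : ν univ = 0
          · simp [h0, hq0]
          · nth_rewrite 2 [← ENNReal.rpow_one (ν univ)]
            rw [← ENNReal.rpow_add _ _ h0 (measure_ne_top _ _)]
            congr 1; ring
      _ = ν univ * K := by
          rw [← ENNReal.mul_rpow_of_nonneg _ _ hq0.le, ← ENNReal.rpow_mul, mul_one_div_cancel hq0.ne',
            ENNReal.rpow_one]

theorem mink_w {X Y : Type*} [MeasurableSpace X] [MeasurableSpace Y] (μ : Measure X) [SFinite μ]
    (ν : Measure Y) [SFinite ν] (p : ℝ≥0∞) (hp : 1 ≤ p) (k : Y → ℝ≥0∞) (hk : Measurable k)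
    (hki : ∫⁻ y, k y ∂ν ≠ ⊤) (f : X → Y → ℝ≥0∞)
    (hf : Measurable (Function.uncurry f)) (K : ℝ≥0∞)
    (hK : ∀ᵐ y ∂ν, eLpNorm (fun x => f x y) p μ ≤ K) :
    eLpNorm (fun x => ∫⁻ y, k y * f x y ∂ν) p μ ≤ (∫⁻ y, k y ∂ν) * K := by
  have : IsFiniteMeasure (ν.withDensity k) := isFiniteMeasure_withDensity hki
  have h := mink_aux μ (ν.withDensity k) p hp f hf K
    ((withDensity_absolutelyContinuous ν k).ae_le hK)
  rw [withDensity_apply _ MeasurableSet.univ, Measure.restrict_univ] at h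
  refine le_of_eq_of_le ?_ h
  congr 1
  funext x
  have hm : Measurable (f x) := hf.comp measurable_prodMk_left
  rw [lintegral_withDensity_eq_lintegral_mul _ hk hm]
  rfl

/-- normalised Lebesgue measure on the closed unit ball -/
def nuB (d : ℕ) : Measure (Euc d) :=
  (volume (closedBall (0 : Euc d) 1))⁻¹ • volume.restrict (closedBall (0 : Euc d) 1)

instance nuB_prob (d : ℕ) : IsProbabilityMeasure (nuB d) := by
  constructor
  rw [nuB, Measure.smul_apply, Measure.restrict_apply MeasurableSet.univ, univ_inter, smul_eq_mul]
  exact ENNReal.inv_mul_cancel (measure_closedBall_pos _ _ one_pos).ne'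
    (measure_closedBall_lt_top).ne

theorem nuB_ae (d : ℕ) : ∀ᵐ u ∂(nuB d), ‖u‖ ≤ 1 := by
  have h : ∀ᵐ u ∂(volume.restrict (closedBall (0 : Euc d) 1)), ‖u‖ ≤ 1 := by
    filter_upwards [ae_restrict_mem measurableSet_closedBall] with u hu
    simpa using hu
  exact Measure.ae_smul_measure h _

/-- the ball average, as an average over the unit ball -/
def avA {d : ℕ} (φ : Euc d → ℝ) (r : ℝ) (x : Euc d) : ℝ := ∫ u, φ (x + r • u) ∂(nuB d)

theorem integral_nuB {d : ℕ} (f : Euc d → ℝ) :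
    ∫ u, f u ∂(nuB d) = ((volume (closedBall (0 : Euc d) 1))⁻¹).toReal *
      ∫ u in closedBall (0 : Euc d) 1, f u := by
  rw [nuB, integral_smul_measure, smul_eq_mul]

theorem vol_cb (d : ℕ) : volume (closedBall (0 : Euc d) 1) = volume (ball (0 : Euc d) 1) := by
  rw [Measure.addHaar_closedBall _ _ zero_le_one]
  simp

theorem cont_param {X : Type*} [TopologicalSpace X] [FirstCountableTopology X]
    [LocallyCompactSpace X] {d : ℕ} (f : X → Euc d → ℝ)
    (hf : Continuous (Function.uncurry f)) : Continuous fun x => ∫ u, f x u ∂(nuB d) := by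
  simp only [integral_nuB]
  exact continuous_const.mul
    (continuous_parametric_integral_of_continuous hf (isCompact_closedBall _ _))

theorem cont_int {d : ℕ} (f : Euc d → ℝ) (hf : Continuous f) : Integrable f (nuB d) := by
  rw [nuB]
  refine Integrable.smul_measure ?_ (by simp [(measure_closedBall_pos volume (0 : Euc d) one_pos).ne'])
  exact hf.continuousOn.integrableOn_compact (isCompact_closedBall _ _)

theorem ballAvg_eq {d : ℕ} (φ : Euc d → ℝ) (r : ℝ) (hr : 0 ≤ r) (x : Euc d) :
    ballAvg φ r x = avA φ r x := by
  rcases hr.eq_or_lt with rfl | hr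
  · simp [ballAvg, avA]
  · have h1 : (closedBall (0 : Euc d) 1 : Set (Euc d)) =ᵐ[volume] ball (0 : Euc d) 1 := by
      refine (ae_eq_of_subset_of_measure_ge ball_subset_closedBall (vol_cb d).le
        measurableSet_ball.nullMeasurableSet measure_closedBall_lt_top.ne).symm
    rw [ballAvg, if_neg hr.ne', avA, integral_nuB, setIntegral_congr_set h1,
      Measure.setIntegral_comp_smul_of_pos volume (fun u => φ (x + u)) _ hr, vol_cb,
      Measure.addHaar_ball_of_pos _ _ hr, smul_unitBall_of_pos hr]
    have h2 : ∫ y in ball x r, φ y = ∫ u in ball (0 : Euc d) r, φ (x + u) := by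
      have := (measurePreserving_add_left (volume : Measure (Euc d)) x).setIntegral_preimage_emb
        (MeasurableEquiv.addLeft x).measurableEmbedding φ (ball x r)
      rw [← this]
      simp
    rw [h2, smul_eq_mul, ENNReal.toReal_mul, ENNReal.toReal_ofReal (by positivity),
      ENNReal.toReal_inv, mul_inv]
    ring

theorem doubleAvg_eq {d : ℕ} (φ : Euc d → ℝ) (r s : ℝ) (hr : 0 ≤ r) (hs : 0 ≤ s) (x : Euc d) :
    doubleAvg φ r s x = avA (avA φ s) r x := by
  rw [doubleAvg, ballAvg_eq _ _ hr]
  congr 1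
  funext y
  exact ballAvg_eq _ _ hs _

theorem eLp_trans {d : ℕ} (p : ℝ≥0∞) {ε : Type*} [TopologicalSpace ε] [ContinuousENorm ε]
    (g : Euc d → ε) (h : Euc d)
    (hg' : AEStronglyMeasurable g volume) :
    eLpNorm (fun x => g (x + h)) p volume = eLpNorm g p volume :=
  eLpNorm_comp_measurePreserving hg' (measurePreserving_add_right volume h)

theorem avA_cont {d : ℕ} (φ : Euc d → ℝ) (hφ : Continuous φ) :
    Continuous fun z : ℝ × Euc d => avA φ z.1 z.2 := by
  unfold avA
  apply cont_param
  fun_prop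

theorem avA_cont' {d : ℕ} (φ : Euc d → ℝ) (hφ : Continuous φ) (r : ℝ) :
    Continuous (avA φ r) := by
  have := (avA_cont φ hφ).comp (by fun_prop : Continuous fun x : Euc d => (r, x))
  exact this

theorem avA2_cont {d : ℕ} (φ : Euc d → ℝ) (hφ : Continuous φ) :
    Continuous fun z : ℝ × ℝ × Euc d => avA (avA φ z.2.1) z.1 z.2.2 := by
  have : (fun z : ℝ × ℝ × Euc d => avA (avA φ z.2.1) z.1 z.2.2) =
    fun z : ℝ × ℝ × Euc d => ∫ u, avA φ z.2.1 (z.2.2 + z.1 • u) ∂(nuB d) := rfl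
  rw [this]
  apply cont_param
  exact (avA_cont φ hφ).comp (g := fun z : ℝ × Euc d => avA φ z.1 z.2)
    (f := fun w : (ℝ × ℝ × Euc d) × Euc d => (w.1.2.1, w.1.2.2 + w.1.1 • w.2)) (by fun_prop)

theorem avA_norm {d : ℕ} (p : ℝ≥0∞) (hp : 1 ≤ p) (ψ : Euc d → ℝ) (hψ : Continuous ψ) (r : ℝ) :
    eLpNorm (avA ψ r) p volume ≤ eLpNorm ψ p volume := by
  have h := mink_aux (volume : Measure (Euc d)) (nuB d) p hp (fun x u => ‖ψ (x + r • u)‖ₑ)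
    (by apply Continuous.measurable; fun_prop) (eLpNorm ψ p volume)
    (by
      refine Filter.Eventually.of_forall fun u => ?_
      rw [eLpNorm_enorm, eLp_trans p ψ _ hψ.aestronglyMeasurable])
  rw [measure_univ, one_mul] at h
  refine le_trans (eLpNorm_mono_enorm fun x => ?_) h
  rw [enorm_eq_self]
  exact enorm_integral_le_lintegral_enorm _

theorem avA_sub {d : ℕ} (φ ψ : Euc d → ℝ) (hφ : Continuous φ) (hψ : Continuous ψ) (r : ℝ)
    (x : Euc d) : avA φ r x - avA ψ r x = avA (fun y => φ y - ψ y) r x := by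
  unfold avA
  rw [integral_sub] <;> exact cont_int _ (by fun_prop)

theorem pd_cd {d : ℕ} (i : Fin d) (φ : Euc d → ℝ) (n : ℕ) (hφ : ContDiff ℝ (n + 1) φ) :
    ContDiff ℝ n (pd i φ) := by
  unfold pd
  exact (hφ.fderiv_right (m := n) le_rfl).clm_apply contDiff_const

theorem deriv_line {d : ℕ} (ψ : Euc d → ℝ) (hψ : ContDiff ℝ 1 ψ) (x h : Euc d) (t : ℝ) :
    HasDerivAt (fun t : ℝ => ψ (x + t • h)) (∑ i, h i * pd i ψ (x + t • h)) t := by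
  have h1 : HasFDerivAt ψ (fderiv ℝ ψ (x + t • h)) (x + t • h) :=
    (hψ.differentiable (by norm_num)).differentiableAt.hasFDerivAt
  have h2 : HasDerivAt (fun t : ℝ => x + t • h) h t := by
    simpa using ((hasDerivAt_id t).smul_const h).const_add x
  have h3 := h1.comp_hasDerivAt t h2
  refine h3.congr_deriv ?_
  have hh : h = ∑ i, h i • EuclideanSpace.single i (1 : ℝ) := by
    ext j
    simp [Finset.sum_apply, Pi.single_apply]
  have h4 := congrArg (fderiv ℝ ψ (x + t • h)) hh
  rw [map_sum] at h4
  rw [h4]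
  simp only [map_smul, smul_eq_mul, pd]

theorem taylor2 {d : ℕ} (φ : Euc d → ℝ) (hφ : ContDiff ℝ 2 φ) (x h : Euc d) :
    φ (x + h) - φ x - ∑ i, h i * pd i φ x =
      ∫ t in (0 : ℝ)..1, (1 - t) * ∑ i, h i * ∑ j, h j * pd j (pd i φ) (x + t • h) := by
  have hc1 : ∀ i, ContDiff ℝ 1 (pd i φ) := fun i => pd_cd i φ 1 (by exact_mod_cast hφ)
  have hc2 : ∀ i j, Continuous (pd j (pd i φ)) := fun i j =>
    (pd_cd j (pd i φ) 0 (by simpa using hc1 i)).continuous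
  have hd : ∀ t : ℝ, HasDerivAt
      (fun t : ℝ => (1 - t) * (∑ i, h i * pd i φ (x + t • h)) + φ (x + t • h))
      ((1 - t) * ∑ i, h i * ∑ j, h j * pd j (pd i φ) (x + t • h)) t := by
    intro t
    have e1 : HasDerivAt (fun t : ℝ => ∑ i, h i * pd i φ (x + t • h))
        (∑ i, h i * ∑ j, h j * pd j (pd i φ) (x + t • h)) t :=
      HasDerivAt.fun_sum fun i _ => (deriv_line (pd i φ) (hc1 i) x h t).const_mul (h i)
    have e2 := deriv_line φ (hφ.of_le (by norm_num)) x h t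
    have e3 : HasDerivAt (fun t : ℝ => 1 - t) (-1) t := by
      simpa using (hasDerivAt_id t).const_sub 1
    have e4 := (e3.mul e1).add e2
    refine e4.congr_deriv ?_
    ring
  rw [intervalIntegral.integral_eq_sub_of_hasDerivAt (fun t _ => hd t)]
  · simp; ring
  · apply Continuous.intervalIntegrable
    fun_prop

theorem nuB_odd {d : ℕ} (f : Euc d → ℝ) (hf : ∀ u, f (-u) = - f u) : ∫ u, f u ∂(nuB d) = 0 := by
  rw [integral_nuB]
  have := (Measure.measurePreserving_neg (volume : Measure (Euc d))).setIntegral_preimage_emb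
    (MeasurableEquiv.neg (Euc d)).measurableEmbedding f (closedBall 0 1)
  have h2 : (fun x : Euc d => -x) ⁻¹' (closedBall 0 1) = closedBall 0 1 := by
    ext u; simp
  simp only [hf, integral_neg] at this
  have h3 : (Neg.neg : Euc d → Euc d) ⁻¹' (closedBall 0 1) = closedBall 0 1 := h2
  rw [h3] at this
  have : ∫ u in closedBall (0 : Euc d) 1, f u = 0 := by linarith
  rw [this, mul_zero]

theorem avA_diff_pt {d : ℕ} (φ : Euc d → ℝ) (hφ : ContDiff ℝ 2 φ) (s : ℝ) (x : Euc d) :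
    ‖avA φ s x - φ x‖ₑ ≤ ENNReal.ofReal (s ^ 2) * ∫⁻ u, (∫⁻ t in Ioc (0 : ℝ) 1,
      ∑ i, ∑ j, ‖pd j (pd i φ) (x + (t * s) • u)‖ₑ) ∂(nuB d) := by
  have hcφ := hφ.continuous
  have hc1 : ∀ i, ContDiff ℝ 1 (pd i φ) := fun i => pd_cd i φ 1 (by exact_mod_cast hφ)
  have hc2 : ∀ i j, Continuous (pd j (pd i φ)) := fun i j =>
    (pd_cd j (pd i φ) 0 (by simpa using hc1 i)).continuous
  have e1 : avA φ s x - φ x =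
      ∫ u, (φ (x + s • u) - φ x - ∑ i, (s • u) i * pd i φ x) ∂(nuB d) := by
    rw [integral_sub, integral_sub, nuB_odd (fun u => ∑ i, (s • u) i * pd i φ x)]
    · simp [avA]
    · intro u
      simp
    · exact cont_int _ (by fun_prop)
    · exact cont_int _ (by fun_prop)
    · exact cont_int _ (by fun_prop)
    · exact cont_int _ (by fun_prop)
  rw [e1]
  refine (enorm_integral_le_lintegral_enorm _).trans ?_
  rw [← lintegral_const_mul' _ _ ENNReal.ofReal_ne_top]
  refine lintegral_mono_ae ?_
  filter_upwards [nuB_ae d] with u hu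
  rw [taylor2 φ hφ, intervalIntegral.integral_of_le zero_le_one]
  refine (enorm_integral_le_lintegral_enorm _).trans ?_
  rw [← lintegral_const_mul' _ _ ENNReal.ofReal_ne_top]
  refine setLIntegral_mono' measurableSet_Ioc fun t ht => ?_
  have hui : ∀ i, |u i| ≤ 1 := fun i => by
    have := PiLp.norm_apply_le u i
    rw [Real.norm_eq_abs] at this
    linarith
  have key : ‖(1 - t) * ∑ i, (s • u) i * ∑ j, (s • u) j * pd j (pd i φ) (x + t • s • u)‖ ≤
      s ^ 2 * ∑ i, ∑ j, ‖pd j (pd i φ) (x + (t * s) • u)‖ := by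
    rw [norm_mul]
    have ht1 : ‖1 - t‖ ≤ 1 := by
      rw [Real.norm_eq_abs, abs_le]; constructor <;> linarith [ht.1, ht.2]
    refine (mul_le_of_le_one_left (norm_nonneg _) ht1).trans ?_
    rw [Finset.mul_sum]
    refine (norm_sum_le _ _).trans (Finset.sum_le_sum fun i _ => ?_)
    rw [Finset.mul_sum, Finset.mul_sum]
    refine (norm_sum_le _ _).trans (Finset.sum_le_sum fun j _ => ?_)
    rw [smul_smul, norm_mul, norm_mul, ← mul_assoc]
    refine mul_le_mul_of_nonneg_right ?_ (norm_nonneg _)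
    simp only [PiLp.smul_apply, smul_eq_mul, norm_mul, Real.norm_eq_abs]
    have : |s| * |u i| * (|s| * |u j|) = s ^ 2 * (|u i| * |u j|) := by
      rw [← sq_abs s]; ring
    rw [this]
    exact mul_le_of_le_one_right (sq_nonneg _) (mul_le_one₀ (hui i) (abs_nonneg _) (hui j))
  have h2 := ENNReal.ofReal_le_ofReal key
  rw [ENNReal.ofReal_mul (sq_nonneg _), ofReal_norm,
    ENNReal.ofReal_sum_of_nonneg (fun i _ => Finset.sum_nonneg fun j _ => norm_nonneg _)] at h2
  refine h2.trans_eq ?_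
  congr 1
  refine Finset.sum_congr rfl fun i _ => ?_
  rw [ENNReal.ofReal_sum_of_nonneg (fun i _ => norm_nonneg _)]
  simp only [ofReal_norm]

theorem le_maxD {d : ℕ} (φ : Euc d → ℝ) (p : ℝ≥0∞) (l : List (Fin d)) (hl : l.length ≤ 2) :
    eLpNorm (listD l φ) p volume ≤ maxDle 2 φ p :=
  le_iSup₂ (f := fun (l : List (Fin d)) (_ : l.length ≤ 2) => eLpNorm (listD l φ) p volume) l hl

theorem avA_diff_norm {d : ℕ} (p : ℝ≥0∞) (hp : 1 ≤ p) (φ : Euc d → ℝ) (hφ : ContDiff ℝ 2 φ)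
    (s : ℝ) :
    eLpNorm (fun x => avA φ s x - φ x) p volume ≤
      ENNReal.ofReal (s ^ 2) * ((d : ℝ≥0∞) * ((d : ℝ≥0∞) * maxDle 2 φ p)) := by
  have hc1 : ∀ i, ContDiff ℝ 1 (pd i φ) := fun i => pd_cd i φ 1 (by exact_mod_cast hφ)
  have hc2 : ∀ i j, Continuous (pd j (pd i φ)) := fun i j =>
    (pd_cd j (pd i φ) 0 (by simpa using hc1 i)).continuous
  set H : Euc d → ℝ≥0∞ := fun y => ∑ i, ∑ j, ‖pd j (pd i φ) y‖ₑ with hH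
  have hHm : Measurable H := by
    refine Finset.measurable_sum _ fun i _ => Finset.measurable_sum _ fun j _ => ?_
    exact (hc2 i j).enorm.measurable
  have hHn : eLpNorm H p volume ≤ (d : ℝ≥0∞) * ((d : ℝ≥0∞) * maxDle 2 φ p) := by
    have e : H = ∑ i, ∑ j, fun y => ‖pd j (pd i φ) y‖ₑ := by
      funext y; simp [hH, Finset.sum_apply]
    rw [e]
    have hm : ∀ i j, AEStronglyMeasurable (fun y => ‖pd j (pd i φ) y‖ₑ) volume :=
      fun i j => (hc2 i j).enorm.measurable.aestronglyMeasurable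
    have inner : ∀ i, eLpNorm (∑ j, fun y => ‖pd j (pd i φ) y‖ₑ) p volume ≤
        (d : ℝ≥0∞) * maxDle 2 φ p := by
      intro i
      refine (eLpNorm_sum_le (fun j _ => hm i j) hp).trans ?_
      refine (Finset.sum_le_card_nsmul _ _ (maxDle 2 φ p) fun j _ => ?_).trans (by simp)
      rw [eLpNorm_enorm]
      exact le_maxD φ p [j, i] (by simp)
    refine (eLpNorm_sum_le (fun i _ => ?_) hp).trans ?_
    · exact Finset.aestronglyMeasurable_sum _ fun j _ => hm i j
    · exact (Finset.sum_le_card_nsmul _ _ _ fun i _ => inner i).trans (by simp)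
  have hjm : Measurable fun w : (Euc d × Euc d) × ℝ => H (w.1.1 + (w.2 * s) • w.1.2) := by
    refine hHm.comp (Continuous.measurable ?_)
    fun_prop
  have hmono : eLpNorm (fun x => avA φ s x - φ x) p volume ≤
      eLpNorm (fun x => ∫⁻ u, (ENNReal.ofReal (s ^ 2) * ∫⁻ t in Ioc (0 : ℝ) 1,
        H (x + (t * s) • u)) ∂(nuB d)) p volume := by
    refine eLpNorm_mono_enorm fun x => ?_
    rw [enorm_eq_self, lintegral_const_mul' _ _ ENNReal.ofReal_ne_top]
    exact avA_diff_pt φ hφ s x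
  refine hmono.trans ?_
  have h := mink_w (volume : Measure (Euc d)) (nuB d) p hp (fun _ => ENNReal.ofReal (s ^ 2))
    measurable_const (by simp) (fun x u => ∫⁻ t in Ioc (0 : ℝ) 1, H (x + (t * s) • u))
    (by
      exact Measurable.lintegral_prod_right
        (f := fun (w : Euc d × Euc d) (t : ℝ) => H (w.1 + (t * s) • w.2)) hjm)
    ((d : ℝ≥0∞) * ((d : ℝ≥0∞) * maxDle 2 φ p))
    (by
      refine Filter.Eventually.of_forall fun u => ?_
      have h' := mink_aux (volume : Measure (Euc d)) (volume.restrict (Ioc (0 : ℝ) 1)) p hp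
        (fun x t => H (x + (t * s) • u)) (by
          refine hHm.comp (Continuous.measurable ?_)
          fun_prop) (eLpNorm H p volume) (by
          refine Filter.Eventually.of_forall fun t => ?_
          rw [eLp_trans p H _ hHm.aestronglyMeasurable])
      refine (h'.trans_eq ?_).trans hHn
      simp)
  simpa using h

theorem avA_diff_b {d : ℕ} (p : ℝ≥0∞) (hp : 1 ≤ p) (φ : Euc d → ℝ) (hφ : ContDiff ℝ 2 φ)
    (s b : ℝ) (hs : 0 < s) (hb0 : 0 < b) (hb2 : b < 2) :
    eLpNorm (fun x => avA φ s x - φ x) p volume ≤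
      ENNReal.ofReal (((d : ℝ) ^ 2 + 2) * s ^ b) * maxDle 2 φ p := by
  rcases le_total s 1 with h1 | h1
  · refine (avA_diff_norm p hp φ hφ s).trans ?_
    have : ENNReal.ofReal (s ^ 2) * ((d : ℝ≥0∞) * ((d : ℝ≥0∞) * maxDle 2 φ p)) =
        ENNReal.ofReal ((d : ℝ) ^ 2 * s ^ 2) * maxDle 2 φ p := by
      rw [ENNReal.ofReal_mul (by positivity), ENNReal.ofReal_pow (by positivity) (p := (d : ℝ)),
        ENNReal.ofReal_natCast]
      ring
    rw [this]
    gcongr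
    · linarith
    · rw [← Real.rpow_natCast]
      exact Real.rpow_le_rpow_of_exponent_ge hs h1 (by push_cast; linarith)
  · have h2 : eLpNorm (fun x => avA φ s x - φ x) p volume ≤ maxDle 2 φ p + maxDle 2 φ p := by
      have h0 : eLpNorm φ p volume ≤ maxDle 2 φ p := le_maxD φ p [] (by simp)
      refine (eLpNorm_sub_le (avA_cont' φ hφ.continuous s).aestronglyMeasurable
        hφ.continuous.aestronglyMeasurable hp).trans ?_
      exact add_le_add ((avA_norm p hp φ hφ.continuous s).trans h0) h0
    refine h2.trans ?_
    rw [← two_mul]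
    gcongr
    have : (2 : ℝ≥0∞) = ENNReal.ofReal 2 := by simp
    rw [this]
    refine ENNReal.ofReal_le_ofReal ?_
    have := Real.one_le_rpow h1 hb0.le
    nlinarith [sq_nonneg (d : ℝ)]

theorem avA2_diff_b {d : ℕ} (p : ℝ≥0∞) (hp : 1 ≤ p) (φ : Euc d → ℝ) (hφ : ContDiff ℝ 2 φ)
    (r s b : ℝ) (hs : 0 < s) (hb0 : 0 < b) (hb2 : b < 2) :
    eLpNorm (fun x => avA (avA φ s) r x - avA φ r x) p volume ≤
      ENNReal.ofReal (((d : ℝ) ^ 2 + 2) * s ^ b) * maxDle 2 φ p := by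
  refine le_trans ?_ (avA_diff_b p hp φ hφ s b hs hb0 hb2)
  have hc := avA_cont' φ hφ.continuous s
  simp only [avA_sub _ _ hc hφ.continuous]
  exact avA_norm p hp _ (hc.sub hφ.continuous) r

/-- pointwise boundedness of the averages -/
theorem avA_bdd {d : ℕ} (p : ℝ≥0∞) (hp : 1 ≤ p) (φ : Euc d → ℝ) (hφ : Continuous φ)
    (hφp : eLpNorm φ p volume < ⊤) (δ : ℝ) (hδ : 0 < δ) :
    ∃ B : ℝ, ∀ r, δ ≤ r → ∀ x, |avA φ r x| ≤ B := by
  refine ⟨(volume (ball (0 : Euc d) δ) ^ (- (1 / p.toReal)) * eLpNorm φ p volume).toReal, ?_⟩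
  intro r hr x
  have hr0 : 0 < r := hδ.trans_le hr
  rw [← ballAvg_eq φ r hr0.le, ballAvg, if_neg hr0.ne']
  have hV0 : volume (ball x r) ≠ 0 := (measure_ball_pos _ _ hr0).ne'
  have hVt : volume (ball x r) ≠ ⊤ := measure_ball_lt_top.ne
  have hV0' : volume (ball (0 : Euc d) δ) ≠ 0 := (measure_ball_pos _ _ hδ).ne'
  have hVt' : volume (ball (0 : Euc d) δ) ≠ ⊤ := measure_ball_lt_top.ne
  have hle : volume (ball (0 : Euc d) δ) ≤ volume (ball x r) := by
    rw [← Measure.addHaar_ball_center volume x δ]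
    exact measure_mono (ball_subset_ball hr)
  have h1 : ‖∫ y in ball x r, φ y‖ₑ ≤
      eLpNorm φ p volume * volume (ball x r) ^ (1 - 1 / p.toReal) := by
    refine (enorm_integral_le_lintegral_enorm _).trans ?_
    rw [← eLpNorm_one_eq_lintegral_enorm]
    refine (eLpNorm_le_eLpNorm_mul_rpow_measure_univ hp hφ.aestronglyMeasurable).trans ?_
    rw [Measure.restrict_apply MeasurableSet.univ, univ_inter, ENNReal.toReal_one, one_div_one]
    gcongr
    exact Measure.restrict_le_self
  rw [← Real.norm_eq_abs, ← toReal_enorm]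
  refine ENNReal.toReal_mono (ENNReal.mul_ne_top ?_ hφp.ne) ?_
  · exact ENNReal.rpow_ne_top_of_ne_zero hV0' hVt'
  · rw [enorm_mul, ← ENNReal.toReal_inv, Real.enorm_of_nonneg ENNReal.toReal_nonneg,
      ENNReal.ofReal_toReal (by simpa using hV0)]
    calc (volume (ball x r))⁻¹ * ‖∫ y in ball x r, φ y‖ₑ
        ≤ (volume (ball x r))⁻¹ *
          (eLpNorm φ p volume * volume (ball x r) ^ (1 - 1 / p.toReal)) := by gcongr
      _ = volume (ball x r) ^ (-(1 / p.toReal)) * eLpNorm φ p volume := by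
          rw [mul_comm (eLpNorm φ p volume), ← mul_assoc, ← ENNReal.rpow_neg_one,
            ← ENNReal.rpow_add _ _ hV0 hVt]
          congr 2; ring
      _ ≤ _ := by
          gcongr ?_ * _
          rw [ENNReal.rpow_neg, ENNReal.rpow_neg, ENNReal.inv_le_inv]
          exact ENNReal.rpow_le_rpow hle (by positivity)

theorem bdd_int (f : ℝ → ℝ) (c a B : ℝ) (hc : 0 < c) (ha : 0 < a)
    (hf : AEStronglyMeasurable f (volume.restrict (Ioi c))) (hB : ∀ r, c < r → |f r| ≤ B) :
    IntegrableOn (fun r => f r / r ^ (1 + a)) (Ioi c) := by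
  have h1 : IntegrableOn (fun r : ℝ => r ^ (-(1 + a))) (Ioi c) :=
    integrableOn_Ioi_rpow_of_lt (by linarith) hc
  have h2 := Integrable.bdd_mul (c := B) h1 hf (by
    filter_upwards [ae_restrict_mem measurableSet_Ioi] with r hr
    exact hB r hr)
  refine h2.congr ?_
  filter_upwards [ae_restrict_mem measurableSet_Ioi] with r hr
  have : 0 < r := hc.trans hr
  rw [Real.rpow_neg this.le, div_eq_mul_inv]

theorem int_one (c a : ℝ) (hc : 0 < c) (ha : 0 < a) :
    ∫ r in Ioi c, 1 / r ^ (1 + a) = c ^ (-a) / a := by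
  have : ∫ r in Ioi c, 1 / r ^ (1 + a) = ∫ r in Ioi c, r ^ (-(1 + a)) := by
    refine setIntegral_congr_fun measurableSet_Ioi fun r hr => ?_
    have : 0 < r := hc.trans hr
    rw [Real.rpow_neg this.le, one_div]
  rw [this, integral_Ioi_rpow_of_lt (by linarith) hc]
  rw [show -(1 + a) + 1 = -a by ring, neg_div_neg_eq]

theorem lint_one (c a : ℝ) (hc : 0 < c) (ha : 0 < a) :
    ∫⁻ r in Ioi c, ENNReal.ofReal (1 / r ^ (1 + a)) = ENNReal.ofReal (c ^ (-a) / a) := by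
  rw [← int_one c a hc ha, ofReal_integral_eq_lintegral_ofReal]
  · exact bdd_int (fun _ => 1) c a 1 hc ha aestronglyMeasurable_const (by simp)
  · filter_upwards [ae_restrict_mem measurableSet_Ioi] with r hr
    have : 0 < r := hc.trans hr
    simp only [Pi.zero_apply]
    positivity

theorem pt_identity {d : ℕ} (p : ℝ≥0∞) (hp : 1 ≤ p) (a₁ a₂ : ℝ) (ha₁ : 0 < a₁) (ha₂ : 0 < a₂)
    (δ : ℝ) (hδ : 0 < δ) (φ : Euc d → ℝ) (hφ : Continuous φ) (hφp : eLpNorm φ p volume < ⊤)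
    (x : Euc d) :
    (∫ r₁ in Set.Ioi δ, ∫ r₂ in Set.Ioi (1 : ℝ),
      (doubleAvg φ r₁ (δ * r₂) x - φ x) / (r₁ ^ (1 + a₁) * r₂ ^ (1 + a₂)))
      - 1 / a₂ * ∫ r in Set.Ioi δ, (ballAvg φ r x - φ x) / r ^ (1 + a₁) =
    ∫ r₁ in Set.Ioi δ, (∫ r₂ in Set.Ioi (1 : ℝ),
      (avA (avA φ (δ * r₂)) r₁ x - avA φ r₁ x) / r₂ ^ (1 + a₂)) / r₁ ^ (1 + a₁) := by
  obtain ⟨B, hB⟩ := avA_bdd p hp φ hφ hφp δ hδ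
  have hB2 : ∀ r s, δ ≤ s → |avA (avA φ s) r x| ≤ B := by
    intro r s hs
    have := norm_integral_le_of_norm_le_const (μ := nuB d)
      (f := fun u => avA φ s (x + r • u)) (C := B)
      (Filter.Eventually.of_forall fun u => hB s hs _)
    simpa [avA] using this
  have hcF : Continuous fun z : ℝ × ℝ => avA (avA φ (δ * z.2)) z.1 x - avA φ z.1 x := by
    refine Continuous.sub ?_ ?_
    · exact (avA2_cont φ hφ).comp (f := fun z : ℝ × ℝ => (z.1, δ * z.2, x)) (by fun_prop)
    · exact (avA_cont φ hφ).comp (f := fun z : ℝ × ℝ => (z.1, x)) (by fun_prop)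
  have hc1 : Continuous fun r : ℝ => avA φ r x :=
    (avA_cont φ hφ).comp (f := fun r : ℝ => (r, x)) (by fun_prop)
  have hFB : ∀ r₁ r₂, δ < r₁ → 1 < r₂ →
      |avA (avA φ (δ * r₂)) r₁ x - avA φ r₁ x| ≤ B + B := by
    intro r₁ r₂ h1 h2
    refine (abs_sub _ _).trans (add_le_add (hB2 _ _ ?_) (hB _ h1.le _))
    nlinarith
  have hin : ∀ r₁, δ < r₁ → IntegrableOn
      (fun r₂ => (avA (avA φ (δ * r₂)) r₁ x - avA φ r₁ x) / r₂ ^ (1 + a₂)) (Ioi 1) := by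
    intro r₁ h1
    refine bdd_int _ 1 a₂ (B + B) one_pos ha₂ ?_ fun r₂ h2 => hFB r₁ r₂ h1 h2
    exact (hcF.comp (f := fun r₂ : ℝ => (r₁, r₂)) (by fun_prop)).aestronglyMeasurable
  have hone : IntegrableOn (fun r : ℝ => 1 / r ^ (1 + a₂)) (Ioi 1) :=
    bdd_int (fun _ => 1) 1 a₂ 1 one_pos ha₂ aestronglyMeasurable_const (by simp)
  have hI1 : IntegrableOn (fun r => (avA φ r x - φ x) / r ^ (1 + a₁)) (Ioi δ) := by
    refine bdd_int _ δ a₁ (B + |φ x|) hδ ha₁ (hc1.sub continuous_const).aestronglyMeasurable ?_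
    intro r hr
    exact (abs_sub _ _).trans (add_le_add (hB _ hr.le _) le_rfl)
  have hI2 : IntegrableOn (fun r₁ => (∫ r₂ in Set.Ioi (1 : ℝ),
      (avA (avA φ (δ * r₂)) r₁ x - avA φ r₁ x) / r₂ ^ (1 + a₂)) / r₁ ^ (1 + a₁)) (Ioi δ) := by
    refine bdd_int _ δ a₁ (∫ r₂ in Ioi (1 : ℝ), (B + B) / r₂ ^ (1 + a₂)) hδ ha₁ ?_ ?_
    · refine StronglyMeasurable.aestronglyMeasurable ?_
      refine StronglyMeasurable.integral_prod_right ?_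
      refine Measurable.stronglyMeasurable ?_
      refine hcF.measurable.div ?_
      exact (measurable_snd.pow_const _)
    · intro r₁ h1
      rw [← Real.norm_eq_abs]
      refine norm_integral_le_of_norm_le ?_ ?_
      · exact bdd_int (fun _ => B + B) 1 a₂ |B + B| one_pos ha₂ aestronglyMeasurable_const
          (fun _ _ => le_rfl)
      · filter_upwards [ae_restrict_mem measurableSet_Ioi] with r₂ h2
        have h0 : (0 : ℝ) < r₂ := one_pos.trans h2
        rw [norm_div, Real.norm_eq_abs, Real.norm_of_nonneg (by positivity : 0 ≤ r₂ ^ (1 + a₂))]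
        gcongr
        exact hFB r₁ r₂ h1 h2
  have hL : (∫ r₁ in Set.Ioi δ, ∫ r₂ in Set.Ioi (1 : ℝ),
      (doubleAvg φ r₁ (δ * r₂) x - φ x) / (r₁ ^ (1 + a₁) * r₂ ^ (1 + a₂))) =
      ∫ r₁ in Set.Ioi δ, ((∫ r₂ in Set.Ioi (1 : ℝ),
      (avA (avA φ (δ * r₂)) r₁ x - avA φ r₁ x) / r₂ ^ (1 + a₂)) / r₁ ^ (1 + a₁) +
      1 / a₂ * ((avA φ r₁ x - φ x) / r₁ ^ (1 + a₁))) := by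
    refine setIntegral_congr_fun measurableSet_Ioi fun r₁ h1 => ?_
    have hr1 : 0 < r₁ := hδ.trans h1
    have e1 : ∫ r₂ in Set.Ioi (1 : ℝ),
        (doubleAvg φ r₁ (δ * r₂) x - φ x) / (r₁ ^ (1 + a₁) * r₂ ^ (1 + a₂)) =
        ∫ r₂ in Set.Ioi (1 : ℝ), ((avA (avA φ (δ * r₂)) r₁ x - avA φ r₁ x) / r₂ ^ (1 + a₂) /
          r₁ ^ (1 + a₁) + (avA φ r₁ x - φ x) / r₁ ^ (1 + a₁) * (1 / r₂ ^ (1 + a₂))) := by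
      refine setIntegral_congr_fun measurableSet_Ioi fun r₂ h2 => ?_
      have hr2 : (0 : ℝ) < r₂ := one_pos.trans h2
      rw [doubleAvg_eq _ _ _ hr1.le (by positivity)]
      have p1 : 0 < r₁ ^ (1 + a₁) := by positivity
      have p2 : 0 < r₂ ^ (1 + a₂) := by positivity
      field_simp
      ring
    rw [e1, integral_add ((hin r₁ h1).div_const _) (hone.const_mul _), integral_div,
      integral_const_mul, int_one 1 a₂ one_pos ha₂, Real.one_rpow]
    ring
  have hD : ∫ r in Set.Ioi δ, (ballAvg φ r x - φ x) / r ^ (1 + a₁) =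
      ∫ r in Set.Ioi δ, (avA φ r x - φ x) / r ^ (1 + a₁) := by
    refine setIntegral_congr_fun measurableSet_Ioi fun r h1 => ?_
    rw [ballAvg_eq _ _ (hδ.trans h1).le]
  rw [hL, hD, integral_add hI2 (hI1.const_mul _), integral_const_mul]
  ring

theorem main_bound {d : ℕ} (p : ℝ≥0∞) (hp : 1 ≤ p) (a₁ a₂ b : ℝ) (ha₁ : 0 < a₁)
    (hb : a₁ < b) (hb2 : b < 2) (hba : b < a₂)
    (δ : ℝ) (hδ : 0 < δ) (φ : Euc d → ℝ) (hφ : ContDiff ℝ 2 φ) :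
    eLpNorm (fun x => ∫ r₁ in Set.Ioi δ, (∫ r₂ in Set.Ioi (1 : ℝ),
      (avA (avA φ (δ * r₂)) r₁ x - avA φ r₁ x) / r₂ ^ (1 + a₂)) / r₁ ^ (1 + a₁)) p volume ≤
    ENNReal.ofReal (δ ^ (-a₁) / a₁) * (ENNReal.ofReal (1 / (a₂ - b)) *
      (ENNReal.ofReal (((d : ℝ) ^ 2 + 2) * δ ^ b) * maxDle 2 φ p)) := by
  have hφc := hφ.continuous
  have hb0 : 0 < b := ha₁.trans hb
  set F : Euc d → ℝ → ℝ → ℝ≥0∞ := fun x r₁ r₂ =>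
    ‖(avA (avA φ (δ * r₂)) r₁ x - avA φ r₁ x) / r₂ ^ b‖ₑ with hF
  have hFm : Measurable fun w : (Euc d × ℝ) × ℝ => F w.1.1 w.1.2 w.2 := by
    refine Measurable.enorm (Measurable.div (Continuous.measurable ?_)
      (measurable_snd.pow_const _))
    refine Continuous.sub ?_ ?_
    · exact (avA2_cont φ hφc).comp
        (f := fun w : (Euc d × ℝ) × ℝ => (w.1.2, δ * w.2, w.1.1)) (by fun_prop)
    · exact (avA_cont φ hφc).comp (f := fun w : (Euc d × ℝ) × ℝ => (w.1.2, w.1.1)) (by fun_prop)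
  set k₁ : ℝ → ℝ≥0∞ := fun r => ENNReal.ofReal (1 / r ^ (1 + a₁)) with hk₁
  set k₂ : ℝ → ℝ≥0∞ := fun r => ENNReal.ofReal (1 / r ^ (1 + (a₂ - b))) with hk₂
  have hk₁m : Measurable k₁ :=
    (measurable_const.div (measurable_id.pow_const _)).ennreal_ofReal
  have hk₂m : Measurable k₂ :=
    (measurable_const.div (measurable_id.pow_const _)).ennreal_ofReal
  have hk₁i : ∫⁻ r in Ioi δ, k₁ r = ENNReal.ofReal (δ ^ (-a₁) / a₁) := lint_one δ a₁ hδ ha₁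
  have hk₂i : ∫⁻ r in Ioi (1 : ℝ), k₂ r = ENNReal.ofReal (1 / (a₂ - b)) := by
    have := lint_one 1 (a₂ - b) one_pos (by linarith)
    rwa [Real.one_rpow] at this
  have hmono : eLpNorm (fun x => ∫ r₁ in Set.Ioi δ, (∫ r₂ in Set.Ioi (1 : ℝ),
      (avA (avA φ (δ * r₂)) r₁ x - avA φ r₁ x) / r₂ ^ (1 + a₂)) / r₁ ^ (1 + a₁)) p volume ≤
      eLpNorm (fun x => ∫⁻ r₁ in Set.Ioi δ, k₁ r₁ * ∫⁻ r₂ in Set.Ioi (1 : ℝ),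
        k₂ r₂ * F x r₁ r₂) p volume := by
    refine eLpNorm_mono_enorm fun x => ?_
    rw [enorm_eq_self]
    refine (enorm_integral_le_lintegral_enorm _).trans ?_
    refine setLIntegral_mono' measurableSet_Ioi fun r₁ h1 => ?_
    have hr1 : 0 < r₁ := hδ.trans h1
    rw [div_eq_mul_one_div, enorm_mul, mul_comm, Real.enorm_of_nonneg (by positivity)]
    refine mul_le_mul_right ?_ _
    refine (enorm_integral_le_lintegral_enorm _).trans ?_
    refine setLIntegral_mono' measurableSet_Ioi fun r₂ h2 => ?_
    have hr2 : (0 : ℝ) < r₂ := one_pos.trans h2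
    rw [hk₂, hF]
    beta_reduce
    rw [← Real.enorm_of_nonneg (by positivity : (0 : ℝ) ≤ 1 / r₂ ^ (1 + (a₂ - b))), ← enorm_mul]
    refine le_of_eq ?_
    congr 1
    rw [div_mul_div_comm, one_mul, ← Real.rpow_add hr2]
    congr 2
    ring
  refine hmono.trans ?_
  rw [← hk₁i, ← hk₂i]
  refine mink_w volume (volume.restrict (Ioi δ)) p hp k₁ hk₁m (by rw [hk₁i]; simp)
    (fun x r₁ => ∫⁻ r₂ in Set.Ioi (1 : ℝ), k₂ r₂ * F x r₁ r₂) ?_ _ ?_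
  · exact Measurable.lintegral_prod_right
      (f := fun (w : Euc d × ℝ) (r₂ : ℝ) => k₂ r₂ * F w.1 w.2 r₂)
      ((hk₂m.comp measurable_snd).mul hFm)
  · refine Filter.Eventually.of_forall fun r₁ => ?_
    refine mink_w volume (volume.restrict (Ioi (1 : ℝ))) p hp k₂ hk₂m (by rw [hk₂i]; simp)
      (fun x r₂ => F x r₁ r₂) ?_ _ ?_
    · exact hFm.comp (f := fun z : Euc d × ℝ => ((z.1, r₁), z.2)) (by fun_prop)
    · filter_upwards [ae_restrict_mem measurableSet_Ioi] with r₂ h2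
      have hr2 : (0 : ℝ) < r₂ := one_pos.trans h2
      simp only [hF]
      rw [eLpNorm_enorm]
      have e : (fun x => (avA (avA φ (δ * r₂)) r₁ x - avA φ r₁ x) / r₂ ^ b) =
          (1 / r₂ ^ b) • fun x => avA (avA φ (δ * r₂)) r₁ x - avA φ r₁ x := by
        funext x
        simp only [Pi.smul_apply, smul_eq_mul]
        ring
      rw [e, eLpNorm_const_smul, Real.enorm_of_nonneg (by positivity)]
      refine (mul_le_mul_right
        (avA2_diff_b p hp φ hφ r₁ (δ * r₂) b (by positivity) hb0 hb2) _).trans_eq ?_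
      rw [← mul_assoc, ← ENNReal.ofReal_mul (by positivity), Real.mul_rpow hδ.le hr2.le]
      congr 2
      have : 0 < r₂ ^ b := by positivity
      field_simp

/-- two-tails regime, stable case: with `a₁ ∈ (0,2)`, `a₂ > a₁`,
`L^δ φ(x) = u₀ V₁ ∫_δ^∞ ∫₁^∞ (φ̄̄(x, r₁, δ r₂) − φ(x)) dr₁ dr₂/(r₁^{1+a₁} r₂^{1+a₂})`
(the radius `r₁` ranging over `[δ,∞)` and `r₂` over `[1,∞)`) and
`D^δ φ(x) = (u₀ V₁/a₂) ∫_δ^∞ (φ̄(x,r) − φ(x)) dr/r^{1+a₁}`, there exist `C > 0`, `θ > 0`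
such that for all `δ ∈ (0,1)` and all admissible `φ`,
`‖L^δ φ − D^δ φ‖_p ≤ C δ^θ max_{|κ|≤2} ‖∂_κ φ‖_p`. -/
theorem stmt18 (d : ℕ) (hd : 1 ≤ d) (u₀ : ℝ) (hu : 0 < u₀) (p : ℝ≥0∞) (hp : 1 ≤ p)
    (a₁ a₂ : ℝ) (ha₁0 : 0 < a₁) (ha₁2 : a₁ < 2) (ha₂ : a₁ < a₂) :
    ∃ C : ℝ, 0 < C ∧ ∃ θ : ℝ, 0 < θ ∧
      ∀ δ : ℝ, 0 < δ → δ < 1 →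
        ∀ φ : Euc d → ℝ, ContDiff ℝ 2 φ → maxDle 2 φ p < ⊤ →
          eLpNorm (fun x =>
              (u₀ * V1 d *
                ∫ r₁ in Set.Ioi δ, ∫ r₂ in Set.Ioi (1 : ℝ),
                  (doubleAvg φ r₁ (δ * r₂) x - φ x) / (r₁ ^ (1 + a₁) * r₂ ^ (1 + a₂)))
              - u₀ * V1 d / a₂ *
                ∫ r in Set.Ioi δ, (ballAvg φ r x - φ x) / r ^ (1 + a₁)) p volume
          ≤ ENNReal.ofReal (C * δ ^ θ) * maxDle 2 φ p := by
  set b : ℝ := (a₁ + min 2 a₂) / 2 with hbdef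
  have hm : a₁ < min 2 a₂ := lt_min ha₁2 ha₂
  have hb : a₁ < b := by rw [hbdef]; linarith
  have hb2 : b < 2 := by rw [hbdef]; linarith [min_le_left 2 a₂]
  have hba : b < a₂ := by rw [hbdef]; linarith [min_le_right 2 a₂]
  have hV : 0 < V1 d := ENNReal.toReal_pos (measure_ball_pos _ _ one_pos).ne'
    measure_ball_lt_top.ne
  have hab : 0 < a₂ - b := by linarith
  refine ⟨u₀ * V1 d * (((d : ℝ) ^ 2 + 2) / (a₁ * (a₂ - b))), by positivity, b - a₁,
    by linarith, ?_⟩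
  intro δ hδ hδ1 φ hφ hM
  have hφp : eLpNorm φ p volume < ⊤ := (le_maxD φ p [] (by simp)).trans_lt hM
  have e : (fun x =>
      (u₀ * V1 d *
        ∫ r₁ in Set.Ioi δ, ∫ r₂ in Set.Ioi (1 : ℝ),
          (doubleAvg φ r₁ (δ * r₂) x - φ x) / (r₁ ^ (1 + a₁) * r₂ ^ (1 + a₂)))
      - u₀ * V1 d / a₂ *
        ∫ r in Set.Ioi δ, (ballAvg φ r x - φ x) / r ^ (1 + a₁)) =
      (u₀ * V1 d) • fun x => ∫ r₁ in Set.Ioi δ, (∫ r₂ in Set.Ioi (1 : ℝ),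
        (avA (avA φ (δ * r₂)) r₁ x - avA φ r₁ x) / r₂ ^ (1 + a₂)) / r₁ ^ (1 + a₁) := by
    funext x
    simp only [Pi.smul_apply, smul_eq_mul]
    rw [← pt_identity p hp a₁ a₂ ha₁0 (ha₁0.trans ha₂) δ hδ φ hφ.continuous hφp x]
    ring
  rw [e, eLpNorm_const_smul, Real.enorm_of_nonneg (by positivity)]
  refine (mul_le_mul_right
    (main_bound p hp a₁ a₂ b ha₁0 hb hb2 hba δ hδ φ hφ) _).trans_eq ?_
  rw [← mul_assoc, ← mul_assoc, ← mul_assoc, ← ENNReal.ofReal_mul (by positivity),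
    ← ENNReal.ofReal_mul (by positivity), ← ENNReal.ofReal_mul (by positivity)]
  congr 2
  rw [show b - a₁ = -a₁ + b by ring, Real.rpow_add hδ]
  field_simp

end
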